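/- arXiv:2311.07219 — 3 statements merged into one kernel-verified Lean document; each statement's English description precedes it below -/
import Mathlib

section
/- Let G = (V,E) be a finite simple graph with a co-comparability ordering ≺. Let u, v ∈ V be distinct vertices, let I_u be a maximum independent set of G containing u and let I_v be a maximum independent set of G containing v. If pos_{I_u}(u) = pos_{I_v}(v), then uv ∈ E. -/
/-- An independent set (as a finset): pairwise non-adjacent vertices. -/
def IsIndep {V : Type*} (G : SimpleGraph V) (I : Finset V) : Prop :=
  ∀ u ∈ I, ∀ v ∈ I, u ≠ v → ¬ G.Adj u v

/-- The independence number `α(G)`: the maximum size of an independent set. -/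
noncomputable def indepNum {V : Type*} (G : SimpleGraph V) : ℕ :=
  sSup {n | ∃ I : Finset V, IsIndep G I ∧ I.card = n}

/-- `pos_I(v) = |{u ∈ I : u ≺ v}| + 1`. -/
def posIn {V : Type*} [LinearOrder V] (I : Finset V) (v : V) : ℕ :=
  (I.filter fun u => u < v).card + 1

theorem IsIndep.card_le_indepNum {V : Type*} [Fintype V] {G : SimpleGraph V} {I : Finset V}
    (hI : IsIndep G I) : I.card ≤ indepNum G := by
  refine le_csSup ⟨Fintype.card V, ?_⟩ ⟨I, hI, rfl⟩
  rintro n ⟨J, -, rfl⟩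
  exact J.card_le_univ

theorem card_filter_le_eq_posIn {V : Type*} [LinearOrder V] {I : Finset V} {v : V}
    (hv : v ∈ I) : (I.filter fun x => x ≤ v).card = posIn I v := by
  have h : (I.filter fun x => x ≤ v) = insert v (I.filter fun x => x < v) := by
    ext x
    simp only [Finset.mem_filter, Finset.mem_insert, le_iff_lt_or_eq]
    grind
  rw [h, Finset.card_insert_of_notMem (by simp), posIn]

/-- Joining the part of `I` up to `u` with the part of `J` from `v` on, for non-adjacent `u < v`,
gives an independent set. -/
theorem IsIndep.union_filter_of_not_adj {V : Type*} [LinearOrder V] {G : SimpleGraph V}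
    (hco : ∀ u v w : V, u < v → v < w → ¬ G.Adj u v → ¬ G.Adj v w → ¬ G.Adj u w)
    {u v : V} (huv : u < v) (hadj : ¬ G.Adj u v) {I J : Finset V}
    (hI : IsIndep G I) (hu : u ∈ I) (hJ : IsIndep G J) (hv : v ∈ J) :
    IsIndep G ((I.filter fun x => x ≤ u) ∪ J.filter fun x => v ≤ x) := by
  have cross : ∀ a ∈ I, a ≤ u → ∀ b ∈ J, v ≤ b → ¬ G.Adj a b := by
    intro a ha hau b hb hvb
    have hav : ¬ G.Adj a v := by
      rcases hau.eq_or_lt with rfl | hlt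
      · exact hadj
      · exact hco a u v hlt huv (hI a ha u hu hlt.ne) hadj
    rcases hvb.eq_or_lt with rfl | hlt
    · exact hav
    · exact hco a v b (hau.trans_lt huv) hlt hav (hJ v hv b hb hlt.ne)
  intro a ha b hb hab
  simp only [Finset.mem_union, Finset.mem_filter] at ha hb
  rcases ha with ⟨ha, hau⟩ | ⟨ha, hva⟩ <;> rcases hb with ⟨hb, hbu⟩ | ⟨hb, hvb⟩
  · exact hI a ha b hb hab
  · exact cross a ha hau b hb hvb
  · exact fun h => cross b hb hbu a ha hva h.symm
  · exact hJ a ha b hb hab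

theorem adj_of_lt_of_posIn_eq {V : Type*} [Fintype V] [LinearOrder V] {G : SimpleGraph V}
    (hco : ∀ u v w : V, u < v → v < w → ¬ G.Adj u v → ¬ G.Adj v w → ¬ G.Adj u w)
    {u v : V} (huv : u < v) {I J : Finset V} (hI : IsIndep G I) (hu : u ∈ I)
    (hJ : IsIndep G J) (hJcard : J.card = indepNum G) (hv : v ∈ J)
    (hpos : posIn I u = posIn J v) : G.Adj u v := by
  by_contra hadj
  have hle := (hI.union_filter_of_not_adj hco huv hadj hu hJ hv).card_le_indepNum
  have hdisj : Disjoint (I.filter fun x => x ≤ u) (J.filter fun x => v ≤ x) := by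
    rw [Finset.disjoint_left]
    intro x hx hx'
    exact (((Finset.mem_filter.1 hx).2.trans_lt huv).trans_le (Finset.mem_filter.1 hx').2).false
  rw [Finset.card_union_of_disjoint hdisj, card_filter_le_eq_posIn hu, hpos, posIn] at hle
  have hsplit := J.card_filter_add_card_filter_not (fun x => x < v)
  simp only [not_lt] at hsplit
  omega

/-- In a finite graph with a co-comparability ordering, if `u ≠ v`,
`I_u` is a maximum independent set containing `u`, `I_v` is a maximum independent set
containing `v`, and `pos_{I_u}(u) = pos_{I_v}(v)`, then `uv ∈ E`. -/
theorem stmt5 {V : Type*} [Fintype V] [LinearOrder V] (G : SimpleGraph V)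
    (hco : ∀ u v w : V, u < v → v < w → ¬ G.Adj u v → ¬ G.Adj v w → ¬ G.Adj u w)
    (u v : V) (huv : u ≠ v) (Iu Iv : Finset V)
    (hIu : IsIndep G Iu) (hIucard : Iu.card = indepNum G) (huIu : u ∈ Iu)
    (hIv : IsIndep G Iv) (hIvcard : Iv.card = indepNum G) (hvIv : v ∈ Iv)
    (hpos : posIn Iu u = posIn Iv v) :
    G.Adj u v := by
  rcases huv.lt_or_gt with h | h
  · exact adj_of_lt_of_posIn_eq hco h hIu huIu hIv hIvcard hvIv hpos
  · exact (adj_of_lt_of_posIn_eq hco h hIv hvIv hIu hIucard huIu hpos.symm).symm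
end

section
/- Let G = (V,E) be a finite simple graph with a co-comparability ordering ≺ and V ≠ ∅. Then α(G) equals the maximum over all vertices v ∈ V of the quantity (maximum cardinality of a left extension of v) + (maximum cardinality of a right extension of v) + 1. -/
/-- A left extension of `v`: an independent set all of whose vertices are
before `v` in the ordering and non-adjacent to `v`. -/
def IsLeftExt {V : Type*} [LinearOrder V] (G : SimpleGraph V) (v : V) (I : Finset V) : Prop :=
  IsIndep G I ∧ ∀ u ∈ I, u < v ∧ ¬ G.Adj u v

/-- A right extension of `v`: an independent set all of whose vertices are
after `v` in the ordering and non-adjacent to `v`. -/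
def IsRightExt {V : Type*} [LinearOrder V] (G : SimpleGraph V) (v : V) (I : Finset V) : Prop :=
  IsIndep G I ∧ ∀ u ∈ I, v < u ∧ ¬ G.Adj u v

/-- The maximum cardinality of a left extension of `v`. -/
noncomputable def leftExtNum {V : Type*} [LinearOrder V] (G : SimpleGraph V) (v : V) : ℕ :=
  sSup {n | ∃ I : Finset V, IsLeftExt G v I ∧ I.card = n}

/-- The maximum cardinality of a right extension of `v`. -/
noncomputable def rightExtNum {V : Type*} [LinearOrder V] (G : SimpleGraph V) (v : V) : ℕ :=
  sSup {n | ∃ I : Finset V, IsRightExt G v I ∧ I.card = n}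

theorem card_le_sSup_card {V : Type*} [Fintype V] {P : Finset V → Prop} {I : Finset V}
    (hI : P I) : I.card ≤ sSup {n | ∃ J : Finset V, P J ∧ J.card = n} := by
  refine le_csSup ⟨Fintype.card V, ?_⟩ ⟨I, hI, rfl⟩
  rintro n ⟨J, -, rfl⟩
  exact J.card_le_univ

theorem exists_card_eq_sSup_card {V : Type*} [Fintype V] {P : Finset V → Prop}
    (h : ∃ I, P I) : ∃ I, P I ∧ I.card = sSup {n | ∃ J : Finset V, P J ∧ J.card = n} := by
  obtain ⟨I, hI⟩ := h
  refine Nat.sSup_mem (s := {n | ∃ J : Finset V, P J ∧ J.card = n}) ⟨_, I, hI, rfl⟩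
    ⟨Fintype.card V, ?_⟩
  rintro n ⟨J, -, rfl⟩
  exact J.card_le_univ

theorem IsIndep.subset {V : Type*} {G : SimpleGraph V} {I J : Finset V} (hJ : IsIndep G J)
    (hIJ : I ⊆ J) : IsIndep G I :=
  fun u hu v hv => hJ u (hIJ hu) v (hIJ hv)

/-- An independent set containing `v` splits at `v` into a left and a right extension of `v`. -/
theorem IsIndep.card_le_of_mem {V : Type*} [Fintype V] [LinearOrder V] {G : SimpleGraph V}
    {I : Finset V} (hI : IsIndep G I) {v : V} (hv : v ∈ I) :
    I.card ≤ leftExtNum G v + rightExtNum G v + 1 := by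
  have hL : IsLeftExt G v (I.filter (· < v)) :=
    ⟨hI.subset (I.filter_subset _), fun u hu => by
      rw [Finset.mem_filter] at hu
      exact ⟨hu.2, hI u hu.1 v hv hu.2.ne⟩⟩
  have hR : IsRightExt G v (I.filter (v < ·)) :=
    ⟨hI.subset (I.filter_subset _), fun u hu => by
      rw [Finset.mem_filter] at hu
      exact ⟨hu.2, hI u hu.1 v hv hu.2.ne'⟩⟩
  have hL' : _ ≤ leftExtNum G v := card_le_sSup_card hL
  have hR' : _ ≤ rightExtNum G v := card_le_sSup_card hR
  have hsub : I ⊆ insert v (I.filter (· < v) ∪ I.filter (v < ·)) := by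
    intro u hu
    rcases lt_trichotomy u v with h | h | h <;> simp [hu, h]
  have h₁ := Finset.card_le_card hsub
  have h₂ := Finset.card_insert_le v (I.filter (· < v) ∪ I.filter (v < ·))
  have h₃ := Finset.card_union_le (I.filter (· < v)) (I.filter (v < ·))
  omega

/-- In a co-comparability ordering, a left and a right extension of `v` combine with `v` to an
independent set. -/
theorem IsLeftExt.isIndep_insert_union {V : Type*} [LinearOrder V] {G : SimpleGraph V}
    (hco : ∀ u v w : V, u < v → v < w → ¬ G.Adj u v → ¬ G.Adj v w → ¬ G.Adj u w)
    {v : V} {L R : Finset V} (hL : IsLeftExt G v L) (hR : IsRightExt G v R) :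
    IsIndep G (insert v (L ∪ R)) := by
  have hLR : ∀ x ∈ L, ∀ y ∈ R, ¬ G.Adj x y := fun x hx y hy =>
    hco x v y (hL.2 x hx).1 (hR.2 y hy).1 (hL.2 x hx).2 fun h => (hR.2 y hy).2 h.symm
  intro x hx y hy hxy
  simp only [Finset.mem_insert, Finset.mem_union] at hx hy
  rcases hx with rfl | hx | hx <;> rcases hy with rfl | hy | hy
  · exact absurd rfl hxy
  · exact fun h => (hL.2 y hy).2 h.symm
  · exact fun h => (hR.2 y hy).2 h.symm
  · exact (hL.2 x hx).2
  · exact hL.1 x hx y hy hxy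
  · exact hLR x hx y hy
  · exact (hR.2 x hx).2
  · exact fun h => hLR y hy x hx h.symm
  · exact hR.1 x hx y hy hxy

theorem IsLeftExt.card_insert_union {V : Type*} [LinearOrder V] {G : SimpleGraph V}
    {v : V} {L R : Finset V} (hL : IsLeftExt G v L) (hR : IsRightExt G v R) :
    (insert v (L ∪ R)).card = L.card + R.card + 1 := by
  rw [Finset.card_insert_of_notMem, Finset.card_union_of_disjoint]
  · exact Finset.disjoint_left.2 fun x hx hx' => (hL.2 x hx).1.not_gt (hR.2 x hx').1
  · rw [Finset.mem_union]
    rintro (h | h)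
    · exact (hL.2 v h).1.false
    · exact (hR.2 v h).1.false

theorem leftExtNum_add_rightExtNum_add_one_le {V : Type*} [Fintype V] [LinearOrder V]
    {G : SimpleGraph V}
    (hco : ∀ u v w : V, u < v → v < w → ¬ G.Adj u v → ¬ G.Adj v w → ¬ G.Adj u w) (v : V) :
    leftExtNum G v + rightExtNum G v + 1 ≤ indepNum G := by
  obtain ⟨L, hL, hLc⟩ := exists_card_eq_sSup_card (P := IsLeftExt G v)
    ⟨∅, by simp [IsLeftExt, IsIndep]⟩
  obtain ⟨R, hR, hRc⟩ := exists_card_eq_sSup_card (P := IsRightExt G v)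
    ⟨∅, by simp [IsRightExt, IsIndep]⟩
  rw [leftExtNum, rightExtNum, ← hLc, ← hRc, ← hL.card_insert_union hR]
  exact card_le_sSup_card (hL.isIndep_insert_union hco hR)

/-- In a finite nonempty graph with a co-comparability ordering,
`α(G)` equals the maximum over all vertices `v` of
`(max size of a left extension of v) + (max size of a right extension of v) + 1`. -/
theorem stmt8 {V : Type*} [Fintype V] [Nonempty V] [LinearOrder V] (G : SimpleGraph V)
    (hco : ∀ u v w : V, u < v → v < w → ¬ G.Adj u v → ¬ G.Adj v w → ¬ G.Adj u w) :
    indepNum G = Finset.univ.sup (fun v : V => leftExtNum G v + rightExtNum G v + 1) := by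
  refine le_antisymm ?_ (Finset.sup_le fun v _ => leftExtNum_add_rightExtNum_add_one_le hco v)
  obtain ⟨I, hI, hIc⟩ := exists_card_eq_sSup_card (P := IsIndep G) ⟨∅, by simp [IsIndep]⟩
  rw [indepNum, ← hIc]
  obtain rfl | ⟨v, hv⟩ := I.eq_empty_or_nonempty
  · simp
  · exact (hI.card_le_of_mem hv).trans
      (Finset.le_sup (f := fun v => leftExtNum G v + rightExtNum G v + 1) (Finset.mem_univ v))
end

section
/- Let G = (V,E) be a finite simple graph with a co-comparability ordering ≺, let v ∈ V, and let I₁, I₂ be two independent sets containing v, each of maximum cardinality among all independent sets of G containing v. Then pos_{I₁}(v) = pos_{I₂}(v). -/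
/-- Splicing the part of `I` below `v` with the part of `J` from `v` on gives an independent set. -/
theorem IsIndep.splice {V : Type*} [LinearOrder V] {G : SimpleGraph V}
    (hco : ∀ u v w : V, u < v → v < w → ¬ G.Adj u v → ¬ G.Adj v w → ¬ G.Adj u w)
    {v : V} {I J : Finset V} (hI : IsIndep G I) (hvI : v ∈ I) (hJ : IsIndep G J) (hvJ : v ∈ J) :
    IsIndep G ((I.filter fun u => u < v) ∪ J.filter fun u => ¬ u < v) := by
  have cross : ∀ x ∈ I, x < v → ∀ y ∈ J, ¬ y < v → ¬ G.Adj x y := by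
    intro x hx hxv y hy hyv
    rcases (not_lt.mp hyv).eq_or_lt with rfl | hvy
    · exact hI x hx v hvI hxv.ne
    · exact hco x v y hxv hvy (hI x hx v hvI hxv.ne) (hJ v hvJ y hy hvy.ne)
  intro x hx y hy hxy
  simp only [Finset.mem_union, Finset.mem_filter] at hx hy
  rcases hx with ⟨hx, hxv⟩ | ⟨hx, hxv⟩ <;> rcases hy with ⟨hy, hyv⟩ | ⟨hy, hyv⟩
  · exact hI x hx y hy hxy
  · exact cross x hx hxv y hy hyv
  · exact fun h => cross y hy hyv x hx hxv h.symm
  · exact hJ x hx y hy hxy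

/-- A maximum independent set through `v` has at least as many vertices below `v` as any other
independent set through `v`. -/
theorem IsIndep.posIn_le {V : Type*} [LinearOrder V] {G : SimpleGraph V}
    (hco : ∀ u v w : V, u < v → v < w → ¬ G.Adj u v → ¬ G.Adj v w → ¬ G.Adj u w)
    {v : V} {I J : Finset V} (hI : IsIndep G I) (hvI : v ∈ I) (hJ : IsIndep G J) (hvJ : v ∈ J)
    (hmax : ∀ K : Finset V, IsIndep G K → v ∈ K → K.card ≤ J.card) :
    posIn I v ≤ posIn J v := by
  have hle := hmax _ (hI.splice hco hvI hJ hvJ) (by simp [hvJ])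
  rw [Finset.card_union_of_disjoint (Finset.disjoint_filter_filter_not I J _)] at hle
  have hsplit := J.card_filter_add_card_filter_not (fun u => u < v)
  unfold posIn
  omega

/-- In a finite graph with a co-comparability ordering, if `I₁`, `I₂`
are independent sets containing `v`, each of maximum cardinality among independent sets
containing `v`, then `pos_{I₁}(v) = pos_{I₂}(v)`. -/
theorem stmt10 {V : Type*} [Fintype V] [LinearOrder V] (G : SimpleGraph V)
    (hco : ∀ u v w : V, u < v → v < w → ¬ G.Adj u v → ¬ G.Adj v w → ¬ G.Adj u w)
    (v : V) (I₁ I₂ : Finset V)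
    (h1 : IsIndep G I₁) (hv1 : v ∈ I₁)
    (h1max : ∀ J : Finset V, IsIndep G J → v ∈ J → J.card ≤ I₁.card)
    (h2 : IsIndep G I₂) (hv2 : v ∈ I₂)
    (h2max : ∀ J : Finset V, IsIndep G J → v ∈ J → J.card ≤ I₂.card) :
    posIn I₁ v = posIn I₂ v :=
  le_antisymm (h1.posIn_le hco hv1 h2 hv2 h2max) (h2.posIn_le hco hv2 h1 hv1 h1max)
end
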